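/- Let C be a convex subset of a product E × F of real vector spaces and let f : E × F → ℝ be quasiconvex on C. Suppose the partial infimum g(x) = inf { f(x, y) | y ∈ F, (x, y) ∈ C } is attained for every x in the projection D of C onto E (for each x ∈ D there exists y with (x,y) ∈ C and f(x,y) = g(x)). Then g is quasiconvex on D. -/

import Mathlib

/-- Partial minimization of a quasiconvex function over a convex set yields a
quasiconvex function, provided the partial infimum is attained. -/
theorem quasiconvexOn_partial_inf {E F : Type*} [AddCommGroup E] [Module ℝ E]
    [AddCommGroup F] [Module ℝ F]
    {C : Set (E × F)} (hC : Convex ℝ C) {f : E × F → ℝ}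
    (hf : QuasiconvexOn ℝ C f)
    (hattained : ∀ x ∈ {x : E | ∃ y : F, (x, y) ∈ C}, ∃ y : F, (x, y) ∈ C ∧
      IsLeast {z : ℝ | ∃ y' : F, (x, y') ∈ C ∧ f (x, y') = z} (f (x, y))) :
    QuasiconvexOn ℝ {x : E | ∃ y : F, (x, y) ∈ C}
      (fun x => sInf {z : ℝ | ∃ y : F, (x, y) ∈ C ∧ f (x, y) = z}) := by
  intro r
  convert (hf r).linear_image (LinearMap.fst ℝ E F) using 1
  ext x
  constructor
  · rintro ⟨hx, hr⟩
    obtain ⟨y, hy, hleast⟩ := hattained x hx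
    exact ⟨(x, y), ⟨hy, hleast.csInf_eq.symm.trans_le hr⟩, rfl⟩
  · rintro ⟨⟨_, y⟩, ⟨hy, hr⟩, rfl⟩
    obtain ⟨_, _, hleast⟩ := hattained _ ⟨y, hy⟩
    exact ⟨⟨y, hy⟩, (csInf_le ⟨_, hleast.2⟩ ⟨y, hy, rfl⟩).trans hr⟩
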